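/- arXiv:2512.03595 — 2 statements merged into one kernel-verified Lean document; each statement's English description precedes it below -/
import Mathlib

section
/- Let β > 0 and set E := (βk₄, 0, 0, βk₁). Then for every ξ ∈ ℝ one has q̃(F(E + ξ·k)) = −(k₃²(k₁+k₄)/(1+k₃))·ξ²·(βk₄ + K₀·ξ). In particular, along the kernel direction k the projected nonlinearity is, to leading order, the negative quadratic −2K₄ξ² with K₄ := βk₄k₃²(k₁+k₄)/(2(1+k₃)) > 0. -/
/-- The reaction map of the reversible Gray–Scott model. -/
def grayScottF (k₁ k₂ k₃ k₄ : ℝ) (u : Fin 4 → ℝ) : Fin 4 → ℝ :=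
  ![-(u 0) * (u 1) ^ 2 + k₂ * (u 1) ^ 3 - k₁ * u 0 + k₄ * u 3,
    (u 0) * (u 1) ^ 2 - k₂ * (u 1) ^ 3 - u 1 + k₃ * u 2,
    u 1 - k₃ * u 2,
    k₁ * u 0 - k₄ * u 3]

/-- The kernel direction `k` of the linearization at the boundary equilibrium. -/
def grayScottKer (k₁ k₃ k₄ : ℝ) : Fin 4 → ℝ :=
  ![k₄ * (1 + k₃), -(k₃ * (k₁ + k₄)), -(k₁ + k₄), k₁ * (1 + k₃)]

/-- The linear functional `q̃`. -/
noncomputable def grayScottQtilde (k₁ k₃ k₄ : ℝ) (w : Fin 4 → ℝ) : ℝ :=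
  (w 0 + w 3 - w 1 - w 2) / (2 * (k₁ + k₄) * (1 + k₃))

theorem stmt12 (k₁ k₂ k₃ k₄ : ℝ) (hk₁ : 0 < k₁) (hk₂ : 0 < k₂) (hk₃ : 0 < k₃)
    (hk₄ : 0 < k₄) (β : ℝ) (hβ : 0 < β) :
    (∀ ξ : ℝ,
      grayScottQtilde k₁ k₃ k₄
          (grayScottF k₁ k₂ k₃ k₄ (![β * k₄, 0, 0, β * k₁] + ξ • grayScottKer k₁ k₃ k₄)) =
        -(k₃ ^ 2 * (k₁ + k₄) / (1 + k₃)) * ξ ^ 2 *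
          (β * k₄ + (k₁ * k₂ * k₃ + k₂ * k₃ * k₄ + k₃ * k₄ + k₄) * ξ)) ∧
    0 < β * k₄ * k₃ ^ 2 * (k₁ + k₄) / (2 * (1 + k₃)) := by
  refine ⟨fun ξ => ?_, by positivity⟩
  have hs : k₁ + k₄ ≠ 0 := by positivity
  have ht : 1 + k₃ ≠ 0 := by positivity
  simp only [grayScottQtilde, grayScottF, grayScottKer, Pi.add_apply, Pi.smul_apply, smul_eq_mul,
    Matrix.cons_val]
  field_simp
  ring
end

section
/- Let β > 0 and H > 0, set E := (βk₄, 0, 0, βk₁) and K₄ := βk₄k₃²(k₁+k₄)/(2(1+k₃)). Then there exists δ₀ > 0, depending only on k₁, k₂, k₃, k₄, β and H, such that for every function h : ℝ → ℝ⁴ satisfying ‖h(ξ)‖ ≤ H·ξ² for all ξ ∈ ℝ (Euclidean norm), and for every ξ with |ξ| < δ₀, one has −3K₄ξ² ≤ q̃(F(E + ξ·k + h(ξ))) ≤ −K₄ξ². (This is the quantitative two-sided estimate on the projected nonlinearity along any center-manifold-type perturbation h with h(ξ) = O(ξ²).) -/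
/-- Only the cubic reaction term survives under the functional `q̃`. -/
lemma grayScottQtilde_grayScottF (k₁ k₂ k₃ k₄ : ℝ) (u : Fin 4 → ℝ) :
    grayScottQtilde k₁ k₃ k₄ (grayScottF k₁ k₂ k₃ k₄ u) =
      -((u 1) ^ 2 * (u 0 - k₂ * u 1)) / ((k₁ + k₄) * (1 + k₃)) := by
  have h : (grayScottF k₁ k₂ k₃ k₄ u 0 + grayScottF k₁ k₂ k₃ k₄ u 3
      - grayScottF k₁ k₂ k₃ k₄ u 1 - grayScottF k₁ k₂ k₃ k₄ u 2) =
      2 * -((u 1) ^ 2 * (u 0 - k₂ * u 1)) := by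
    simp [grayScottF]
    ring
  rw [grayScottQtilde, h, mul_assoc 2, mul_div_mul_left _ _ two_ne_zero]

/-- A product `x ^ 2 * y` is comparable to `(B * ξ) ^ 2 * A` when `x` and `y` are relatively close
to `-B * ξ` and `A`. -/
lemma sq_mul_mem_Icc_of_abs_le {A B ξ η y : ℝ} (hA : 0 < A) (hB : 0 < B)
    (hη : |η| ≤ B / 10 * |ξ|) (hy : |y - A| ≤ A / 10) :
    (-(B * ξ) + η) ^ 2 * y ∈ Set.Icc (A * B ^ 2 / 2 * ξ ^ 2) (3 * (A * B ^ 2 / 2) * ξ ^ 2) := by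
  have hBξ : |B * ξ| = B * |ξ| := by rw [abs_mul, abs_of_pos hB]
  have hup : |-(B * ξ) + η| ≤ 11 / 10 * (B * |ξ|) := by
    have := abs_add_le (-(B * ξ)) η
    rw [abs_neg, hBξ] at this
    linarith
  have hlo : 9 / 10 * (B * |ξ|) ≤ |-(B * ξ) + η| := by
    have := abs_sub_abs_le_abs_sub (B * ξ) η
    rw [hBξ, abs_sub_comm (B * ξ) η, ← neg_add_eq_sub (B * ξ) η] at this
    linarith
  have hup2 : (-(B * ξ) + η) ^ 2 ≤ 121 / 100 * (B ^ 2 * ξ ^ 2) := by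
    have := pow_le_pow_left₀ (abs_nonneg _) hup 2
    rw [sq_abs, mul_pow, mul_pow, sq_abs] at this
    linarith
  have hlo2 : 81 / 100 * (B ^ 2 * ξ ^ 2) ≤ (-(B * ξ) + η) ^ 2 := by
    have := pow_le_pow_left₀ (by positivity) hlo 2
    rw [sq_abs, mul_pow, mul_pow, sq_abs] at this
    linarith
  obtain ⟨hy1, hy2⟩ := abs_le.mp hy
  have hP : 0 ≤ A * (B ^ 2 * ξ ^ 2) := by positivity
  constructor
  · calc A * B ^ 2 / 2 * ξ ^ 2 ≤ 81 / 100 * (B ^ 2 * ξ ^ 2) * (9 / 10 * A) := by linarith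
      _ ≤ _ := mul_le_mul hlo2 (by linarith) (by positivity) (sq_nonneg _)
  · calc (-(B * ξ) + η) ^ 2 * y ≤ 121 / 100 * (B ^ 2 * ξ ^ 2) * (11 / 10 * A) :=
          mul_le_mul hup2 (by linarith) (by linarith) (by positivity)
      _ ≤ _ := by linarith

theorem stmt13 (k₁ k₂ k₃ k₄ : ℝ) (hk₁ : 0 < k₁) (hk₂ : 0 < k₂) (hk₃ : 0 < k₃)
    (hk₄ : 0 < k₄) (β H : ℝ) (hβ : 0 < β) (hH : 0 < H) :
    ∃ δ₀ : ℝ, 0 < δ₀ ∧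
      ∀ h : ℝ → EuclideanSpace ℝ (Fin 4), (∀ ξ : ℝ, ‖h ξ‖ ≤ H * ξ ^ 2) →
        ∀ ξ : ℝ, |ξ| < δ₀ →
          -3 * (β * k₄ * k₃ ^ 2 * (k₁ + k₄) / (2 * (1 + k₃))) * ξ ^ 2 ≤
            grayScottQtilde k₁ k₃ k₄
              (grayScottF k₁ k₂ k₃ k₄
                (![β * k₄, 0, 0, β * k₁] + ξ • grayScottKer k₁ k₃ k₄ +
                  (fun i => h ξ i))) ∧
          grayScottQtilde k₁ k₃ k₄
              (grayScottF k₁ k₂ k₃ k₄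
                (![β * k₄, 0, 0, β * k₁] + ξ • grayScottKer k₁ k₃ k₄ +
                  (fun i => h ξ i))) ≤
            -(β * k₄ * k₃ ^ 2 * (k₁ + k₄) / (2 * (1 + k₃))) * ξ ^ 2 := by
  set A := β * k₄ with hA
  set B := k₃ * (k₁ + k₄) with hB
  set C := k₄ * (1 + k₃) with hC
  have hA0 : 0 < A := by positivity
  have hB0 : 0 < B := by positivity
  have hC0 : 0 < C := by positivity
  set M := C + H + k₂ * (B + H) with hM
  have hM0 : 0 < M := by positivity
  refine ⟨min 1 (min (B / 10 / H) (A / 10 / M)), by positivity, fun h hh ξ hξ => ?_⟩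
  rw [lt_min_iff, lt_min_iff, lt_div_iff₀ hH, lt_div_iff₀ hM0] at hξ
  obtain ⟨hξ1, hξB, hξA⟩ := hξ
  have hsq : H * ξ ^ 2 ≤ H * |ξ| := by
    rw [← sq_abs]
    nlinarith [mul_nonneg hH.le (abs_nonneg ξ)]
  have hcoord (i : Fin 4) : |h ξ i| ≤ H * ξ ^ 2 :=
    (PiLp.norm_apply_le (h ξ) i).trans (hh ξ)
  have hη : |h ξ 1| ≤ B / 10 * |ξ| := by
    refine (hcoord 1).trans ?_
    rw [← sq_abs]
    nlinarith [abs_nonneg ξ]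
  have hy : |(A + ξ * C + h ξ 0 - k₂ * (-(B * ξ) + h ξ 1)) - A| ≤ A / 10 := by
    obtain ⟨h0, h0'⟩ := abs_le.mp ((hcoord 0).trans hsq)
    obtain ⟨h1, h1'⟩ := abs_le.mp ((hcoord 1).trans hsq)
    have hCB : |ξ * (C + k₂ * B)| = |ξ| * (C + k₂ * B) := by
      rw [abs_mul, abs_of_pos (by positivity : 0 < C + k₂ * B)]
    obtain ⟨h2, h2'⟩ := abs_le.mp hCB.le
    have h3 := mul_le_mul_of_nonneg_left h1 hk₂.le
    have h4 := mul_le_mul_of_nonneg_left h1' hk₂.le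
    rw [hM] at hξA
    rw [abs_le]
    constructor <;> linarith
  obtain ⟨hlo, hup⟩ := sq_mul_mem_Icc_of_abs_le hA0 hB0 hη hy
  have hK : A * k₃ ^ 2 * (k₁ + k₄) / (2 * (1 + k₃)) =
      A * B ^ 2 / 2 / ((k₁ + k₄) * (1 + k₃)) := by
    rw [hB]
    field_simp
  have hD : 0 < (k₁ + k₄) * (1 + k₃) := by positivity
  have hu0 : (![A, 0, 0, β * k₁] + ξ • grayScottKer k₁ k₃ k₄ + (fun i => h ξ i)) 0 =
      A + ξ * C + h ξ 0 := by
    simp [grayScottKer, hC]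
  have hu1 : (![A, 0, 0, β * k₁] + ξ • grayScottKer k₁ k₃ k₄ + (fun i => h ξ i)) 1 =
      -(B * ξ) + h ξ 1 := by
    simp [grayScottKer, hB, mul_comm]
  rw [grayScottQtilde_grayScottF, hu0, hu1, hK]
  constructor
  · rw [le_div_iff₀ hD]
    field_simp
    linarith
  · rw [div_le_iff₀ hD]
    field_simp
    linarith
end
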